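/- arXiv:1705.08735 — 4 statements merged into one kernel-verified Lean document; each statement's English description precedes it below -/
import Mathlib

section
/- (Anchored-circle change of variables in the half-plane.) Let H = ℝ × (0,∞) denote the open upper half-plane in ℝ². Every measurable nonnegative function F : H × H → [0,∞] satisfies ∫_{H} ∫_{H} F(x, u) dx du = ∫_{z ∈ ℝ} ∫_{r=0}^{∞} ∫_{ξ=0}^{π} ∫_{υ=0}^{π} F((z + r cos ξ, r sin ξ), (z + r cos υ, r sin υ)) · r² · |cos υ − cos ξ| dυ dξ dr dz, where all integrals are with respect to Lebesgue measure. -/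
open Real MeasureTheory Set ENNReal

theorem measurableSet_upper_halfPlane : MeasurableSet {p : ℝ × ℝ | 0 < p.2} :=
  measurableSet_lt measurable_const measurable_snd

/-- Integrals over the upper half-plane are invariant under horizontal translations. -/
theorem setLIntegral_halfPlane_add_horizontal (c : ℝ) (g : ℝ × ℝ → ℝ≥0∞) :
    ∫⁻ p in {p : ℝ × ℝ | 0 < p.2}, g (p + (c, 0)) = ∫⁻ p in {p : ℝ × ℝ | 0 < p.2}, g p := by
  have h := (measurePreserving_add_right (volume : Measure (ℝ × ℝ))
    ((c, 0) : ℝ × ℝ)).setLIntegral_comp_preimage_emb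
    (MeasurableEquiv.addRight ((c, 0) : ℝ × ℝ)).measurableEmbedding g {p : ℝ × ℝ | 0 < p.2}
  simpa using h

/-- Polar coordinates in the upper half-plane. -/
theorem setLIntegral_halfPlane_eq_polar {g : ℝ × ℝ → ℝ≥0∞} (hg : Measurable g) :
    ∫⁻ p in {p : ℝ × ℝ | 0 < p.2}, g p =
      ∫⁻ r in Ioi (0 : ℝ), ∫⁻ ξ in Ioo (0 : ℝ) π,
        ENNReal.ofReal r * g (r * cos ξ, r * sin ξ) := by
  have hsub : Ioi (0 : ℝ) ×ˢ Ioo (0 : ℝ) π ⊆ polarCoord.target := by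
    rw [polarCoord_target]
    exact prod_mono_right (Ioo_subset_Ioo_left (by linarith [pi_pos]))
  have hmeas : MeasurableSet (Ioi (0 : ℝ) ×ˢ Ioo (0 : ℝ) π) :=
    measurableSet_Ioi.prod measurableSet_Ioo
  calc
    _ = ∫⁻ p in polarCoord.target, ENNReal.ofReal p.1 •
          {p : ℝ × ℝ | 0 < p.2}.indicator g (polarCoord.symm p) := by
      rw [lintegral_comp_polarCoord_symm, lintegral_indicator measurableSet_upper_halfPlane]
    _ = ∫⁻ p in polarCoord.target, (Ioi (0 : ℝ) ×ˢ Ioo (0 : ℝ) π).indicator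
          (fun p ↦ ENNReal.ofReal p.1 * g (p.1 * cos p.2, p.1 * sin p.2)) p := by
      refine setLIntegral_congr_fun polarCoord.open_target.measurableSet ?_
      rintro ⟨r, θ⟩ ⟨hr, hθ⟩
      have hr : 0 < r := hr
      have hθ : -π < θ ∧ θ < π := hθ
      by_cases h : 0 < θ
      · have hsin : 0 < r * sin θ := mul_pos hr (sin_pos_of_pos_of_lt_pi h hθ.2)
        simp [indicator, hsin, hr, h, hθ.2]
      · have hsin : ¬ 0 < r * sin θ := not_lt.2 <| mul_nonpos_of_nonneg_of_nonpos hr.le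
          (sin_nonpos_of_nonpos_of_neg_pi_le (not_lt.1 h) hθ.1.le)
        simp [indicator, hsin, h]
    _ = ∫⁻ p in Ioi (0 : ℝ) ×ˢ Ioo (0 : ℝ) π,
          ENNReal.ofReal p.1 * g (p.1 * cos p.2, p.1 * sin p.2) := by
      rw [setLIntegral_indicator hmeas, inter_eq_left.2 hsub]
    _ = _ := by
      rw [Measure.volume_eq_prod]
      exact setLIntegral_prod _ (by fun_prop)

/-- The point at angle `p.2` on the circle centered at `(p.1, 0)` passing through `(0, s)`. -/
noncomputable def anchoredCirclePoint (s : ℝ) (p : ℝ × ℝ) : ℝ × ℝ :=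
  (p.1 + √(p.1 ^ 2 + s ^ 2) * cos p.2, √(p.1 ^ 2 + s ^ 2) * sin p.2)

/-- The derivative of `anchoredCirclePoint s`. -/
noncomputable def fderivAnchoredCirclePoint (s : ℝ) (p : ℝ × ℝ) : ℝ × ℝ →L[ℝ] ℝ × ℝ :=
  (Matrix.toLin (.finTwoProd ℝ) (.finTwoProd ℝ)
    !![1 + p.1 / √(p.1 ^ 2 + s ^ 2) * cos p.2, -√(p.1 ^ 2 + s ^ 2) * sin p.2;
      p.1 / √(p.1 ^ 2 + s ^ 2) * sin p.2, √(p.1 ^ 2 + s ^ 2) * cos p.2]).toContinuousLinearMap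

section

variable {s : ℝ}

theorem sqrt_sq_add_sq_pos (hs : 0 < s) (w : ℝ) : 0 < √(w ^ 2 + s ^ 2) := by
  positivity

theorem hasFDerivAt_anchoredCirclePoint (hs : 0 < s) (p : ℝ × ℝ) :
    HasFDerivAt (anchoredCirclePoint s) (fderivAnchoredCirclePoint s p) p := by
  have hρ : HasDerivAt (fun w : ℝ ↦ √(w ^ 2 + s ^ 2)) (p.1 / √(p.1 ^ 2 + s ^ 2)) p.1 := by
    convert! (((hasDerivAt_id p.1).pow 2).add_const (s ^ 2)).sqrt
      (ne_of_gt (sqrt_pos.1 (sqrt_sq_add_sq_pos hs p.1))) using 1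
    simp
    field_simp
  have hρ' := hρ.comp_hasFDerivAt p (hasFDerivAt_fst (𝕜 := ℝ))
  unfold fderivAnchoredCirclePoint
  rw [Matrix.toLin_finTwoProd_toContinuousLinearMap]
  convert! HasFDerivAt.prodMk (𝕜 := ℝ)
    (hasFDerivAt_fst.add
      (hρ'.mul ((hasDerivAt_cos p.2).comp_hasFDerivAt p hasFDerivAt_snd)))
    (hρ'.mul ((hasDerivAt_sin p.2).comp_hasFDerivAt p hasFDerivAt_snd)) using 2 <;>
  ext <;> simp <;> ring

theorem det_fderivAnchoredCirclePoint (hs : 0 < s) (p : ℝ × ℝ) :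
    (fderivAnchoredCirclePoint s p).det = (anchoredCirclePoint s p).1 := by
  have hρ := (sqrt_sq_add_sq_pos hs p.1).ne'
  unfold fderivAnchoredCirclePoint anchoredCirclePoint
  simp only [LinearMap.det_toContinuousLinearMap, LinearMap.det_toLin, Matrix.det_fin_two_of]
  field_simp
  linear_combination p.1 * sin_sq_add_cos_sq p.2

theorem two_mul_anchoredCirclePoint_fst_mul (p : ℝ × ℝ) :
    2 * (anchoredCirclePoint s p).1 * p.1 =
      (anchoredCirclePoint s p).1 ^ 2 + (anchoredCirclePoint s p).2 ^ 2 - s ^ 2 := by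
  have hρ : √(p.1 ^ 2 + s ^ 2) ^ 2 = p.1 ^ 2 + s ^ 2 := sq_sqrt (by positivity)
  simp only [anchoredCirclePoint]
  linear_combination -hρ - √(p.1 ^ 2 + s ^ 2) ^ 2 * sin_sq_add_cos_sq p.2

theorem injOn_anchoredCirclePoint (hs : 0 < s) :
    InjOn (anchoredCirclePoint s)
      ({p | (anchoredCirclePoint s p).1 ≠ 0} ∩ univ ×ˢ Ioo 0 π) := by
  rintro ⟨w, θ⟩ ⟨hp, -, hθ⟩ ⟨w', θ'⟩ ⟨-, -, hθ'⟩ h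
  have hw : w = w' := by
    have h₁ := two_mul_anchoredCirclePoint_fst_mul (s := s) (w, θ)
    have h₂ := two_mul_anchoredCirclePoint_fst_mul (s := s) (w', θ')
    rw [← h, ← h₁] at h₂
    exact (mul_left_cancel₀ (mul_ne_zero two_ne_zero hp) h₂).symm
  subst hw
  have hcos : cos θ = cos θ' := by
    have h₁ := congrArg Prod.fst h
    simp only [anchoredCirclePoint] at h₁
    exact mul_left_cancel₀ (sqrt_sq_add_sq_pos hs w).ne' (add_left_cancel h₁)
  exact congrArg (Prod.mk w) (injOn_cos (Ioo_subset_Icc_self hθ) (Ioo_subset_Icc_self hθ') hcos)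

theorem image_anchoredCirclePoint (hs : 0 < s) :
    anchoredCirclePoint s '' ({p | (anchoredCirclePoint s p).1 ≠ 0} ∩ univ ×ˢ Ioo 0 π) =
      {p | 0 < p.2} ∩ {p | p.1 ≠ 0} := by
  ext ⟨b, t⟩
  constructor
  · rintro ⟨p, ⟨hp, -, hθ⟩, h⟩
    rw [← h]
    exact ⟨mul_pos (sqrt_sq_add_sq_pos hs p.1) (sin_pos_of_mem_Ioo hθ), hp⟩
  · rintro ⟨ht, hb⟩
    have ht : 0 < t := ht
    have hb : b ≠ 0 := hb
    set w := (b ^ 2 + t ^ 2 - s ^ 2) / (2 * b) with hw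
    have hρ := sqrt_sq_add_sq_pos hs w
    have hρ_sq : √(w ^ 2 + s ^ 2) ^ 2 = (b - w) ^ 2 + t ^ 2 := by
      rw [sq_sqrt (by positivity)]
      have : w * (2 * b) = b ^ 2 + t ^ 2 - s ^ 2 := div_mul_cancel₀ _ (by positivity)
      linear_combination this
    set ρ := √(w ^ 2 + s ^ 2) with hρ_def
    have habs : |b - w| < ρ := abs_lt_of_sq_lt_sq (by nlinarith) hρ.le
    have hlt := abs_lt.1 habs
    have h₁ : -1 < (b - w) / ρ := by rw [lt_div_iff₀ hρ]; linarith
    have h₂ : (b - w) / ρ < 1 := by rw [div_lt_iff₀ hρ]; linarith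
    have hθ : arccos ((b - w) / ρ) ∈ Ioo 0 π :=
      ⟨arccos_pos.2 h₂, lt_of_le_of_ne (arccos_le_pi _) fun h ↦ h₁.not_ge (arccos_eq_pi.1 h)⟩
    have hcos : ρ * cos (arccos ((b - w) / ρ)) = b - w := by
      rw [cos_arccos h₁.le h₂.le, mul_div_cancel₀ _ hρ.ne']
    have hsin : ρ * sin (arccos ((b - w) / ρ)) = t := by
      refine (sq_eq_sq₀ (mul_pos hρ (sin_pos_of_mem_Ioo hθ)).le ht.le).1 ?_
      linear_combination ρ ^ 2 * sin_sq_add_cos_sq (arccos ((b - w) / ρ)) + hρ_sq -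
        (ρ * cos (arccos ((b - w) / ρ)) + (b - w)) * hcos
    have heq : anchoredCirclePoint s (w, arccos ((b - w) / ρ)) = (b, t) := by
      simp only [anchoredCirclePoint, ← hρ_def, hcos, hsin, add_sub_cancel]
    exact ⟨_, ⟨by simpa [heq] using hb, mem_univ _, hθ⟩, heq⟩

theorem measurable_anchoredCirclePoint : Measurable (anchoredCirclePoint s) := by
  unfold anchoredCirclePoint
  fun_prop

/-- The upper half-plane parametrized by circles through `(0, s)` centered on the horizontal
axis. -/
theorem setLIntegral_halfPlane_eq_anchoredCirclePoint (hs : 0 < s) {g : ℝ × ℝ → ℝ≥0∞}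
    (hg : Measurable g) :
    ∫⁻ p in {p : ℝ × ℝ | 0 < p.2}, g p =
      ∫⁻ w : ℝ, ∫⁻ υ in Ioo (0 : ℝ) π, g (anchoredCirclePoint s (w, υ)) *
        ENNReal.ofReal |(anchoredCirclePoint s (w, υ)).1| := by
  have hm := measurable_anchoredCirclePoint (s := s)
  have hne : MeasurableSet {p : ℝ × ℝ | (anchoredCirclePoint s p).1 ≠ 0} :=
    (measurableSet_eq_fun hm.fst measurable_const).compl
  have hmeas : MeasurableSet ((univ : Set ℝ) ×ˢ Ioo 0 π) :=
    MeasurableSet.univ.prod measurableSet_Ioo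
  have hvol : ∀ᵐ p : ℝ × ℝ, p ∈ {p : ℝ × ℝ | p.1 ≠ 0} := by
    change {p : ℝ × ℝ | p.1 ≠ 0} ∈ ae volume
    have : {p : ℝ × ℝ | p.1 ≠ 0}ᶜ = {0} ×ˢ univ := by ext; simp
    rw [mem_ae_iff, this, Measure.volume_eq_prod, Measure.prod_prod, volume_singleton, zero_mul]
  calc
    _ = ∫⁻ p in {p : ℝ × ℝ | 0 < p.2} ∩ {p | p.1 ≠ 0}, g p :=
      setLIntegral_congr (inter_ae_eq_left_of_ae_eq_univ (Filter.eventuallyEq_univ.2 hvol)).symm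
    _ = ∫⁻ p in {p | (anchoredCirclePoint s p).1 ≠ 0} ∩ univ ×ˢ Ioo 0 π,
          ENNReal.ofReal |(anchoredCirclePoint s p).1| * g (anchoredCirclePoint s p) := by
      rw [← image_anchoredCirclePoint hs, lintegral_image_eq_lintegral_abs_det_fderiv_mul volume
        (hne.inter hmeas) (fun p _ ↦ (hasFDerivAt_anchoredCirclePoint hs p).hasFDerivWithinAt)
        (injOn_anchoredCirclePoint hs)]
      simp_rw [det_fderivAnchoredCirclePoint hs]
    _ = ∫⁻ p in univ ×ˢ Ioo 0 π,
          g (anchoredCirclePoint s p) * ENNReal.ofReal |(anchoredCirclePoint s p).1| := by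
      rw [← setLIntegral_indicator hne]
      refine lintegral_congr fun p ↦ ?_
      by_cases h : (anchoredCirclePoint s p).1 = 0 <;> simp [indicator, h, mul_comm]
    _ = _ := by
      rw [Measure.volume_eq_prod, setLIntegral_prod, Measure.restrict_univ]
      exact ((hg.comp hm).mul (by fun_prop)).aemeasurable

end

/-- Anchored-circle change of variables in the open upper half-plane `H = ℝ × (0,∞)`:
a pair of points of `H` is parametrized by the center `(z,0)` and radius `r` of the circle
through them centered on the horizontal axis together with two angles `ξ, υ ∈ (0,π)`,
with Jacobian `r²|cos υ - cos ξ|`. -/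
theorem lintegral_halfPlane_pair_eq_anchored_circle
    (F : ℝ × ℝ → ℝ × ℝ → ℝ≥0∞) (hF : Measurable (Function.uncurry F)) :
    (∫⁻ x in {p : ℝ × ℝ | 0 < p.2}, ∫⁻ u in {p : ℝ × ℝ | 0 < p.2}, F x u) =
      ∫⁻ z : ℝ, ∫⁻ r in Ioi (0:ℝ), ∫⁻ ξ in Ioo (0:ℝ) Real.pi, ∫⁻ υ in Ioo (0:ℝ) Real.pi,
        F (z + r * Real.cos ξ, r * Real.sin ξ) (z + r * Real.cos υ, r * Real.sin υ) *
          ENNReal.ofReal (r ^ 2 * |Real.cos υ - Real.cos ξ|) := by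
  set K : ℝ → ℝ × ℝ → ℝ → ℝ≥0∞ := fun z x υ ↦
    F x ((z, 0) + (√((z - x.1) ^ 2 + x.2 ^ 2) * cos υ, √((z - x.1) ^ 2 + x.2 ^ 2) * sin υ)) *
      ENNReal.ofReal |z - x.1 + √((z - x.1) ^ 2 + x.2 ^ 2) * cos υ| with hK
  have hK_meas : Measurable fun q : (ℝ × (ℝ × ℝ)) × ℝ ↦ K q.1.1 q.1.2 q.2 := by
    refine Measurable.mul (hF.comp (Measurable.prodMk ?_ ?_)) ?_ <;> fun_prop
  have hJ_meas : Measurable fun q : ℝ × (ℝ × ℝ) ↦ ∫⁻ υ in Ioo (0 : ℝ) π, K q.1 q.2 υ :=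
    hK_meas.lintegral_prod_right'
  symm
  calc
    _ = ∫⁻ z : ℝ, ∫⁻ p in {p : ℝ × ℝ | 0 < p.2},
          ∫⁻ υ in Ioo (0 : ℝ) π, K z (p + (z, 0)) υ := by
      refine lintegral_congr fun z ↦ ?_
      refine .trans ?_ (setLIntegral_halfPlane_eq_polar
        (hJ_meas.comp (f := fun p : ℝ × ℝ ↦ (z, p + (z, 0))) (by fun_prop))).symm
      refine setLIntegral_congr_fun measurableSet_Ioi fun r hr ↦ lintegral_congr fun ξ ↦ ?_
      have hr : 0 < r := hr
      have hρ : √((r * cos ξ) ^ 2 + (r * sin ξ) ^ 2) = r := by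
        rw [show (r * cos ξ) ^ 2 + (r * sin ξ) ^ 2 = r ^ 2 by
          linear_combination r ^ 2 * sin_sq_add_cos_sq ξ, sqrt_sq hr.le]
      simp only [Function.comp]
      rw [← lintegral_const_mul' _ _ ofReal_ne_top]
      refine lintegral_congr fun υ ↦ ?_
      have habs : r ^ 2 * |cos υ - cos ξ| = r * |-(r * cos ξ) + r * cos υ| := by
        rw [show -(r * cos ξ) + r * cos υ = r * (cos υ - cos ξ) by ring, abs_mul, abs_of_pos hr]
        ring
      rw [habs, ofReal_mul hr.le]
      simp only [hK, Prod.mk_add_mk, add_zero, zero_add, neg_sq, hρ,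
        add_comm (r * cos ξ) z, mul_left_comm, sub_add_cancel_left]
    _ = ∫⁻ z : ℝ, ∫⁻ x in {p : ℝ × ℝ | 0 < p.2}, ∫⁻ υ in Ioo (0 : ℝ) π, K z x υ :=
      lintegral_congr fun z ↦ setLIntegral_halfPlane_add_horizontal z
        fun x ↦ ∫⁻ υ in Ioo (0 : ℝ) π, K z x υ
    _ = ∫⁻ x in {p : ℝ × ℝ | 0 < p.2}, ∫⁻ z : ℝ, ∫⁻ υ in Ioo (0 : ℝ) π, K z x υ :=
      lintegral_lintegral_swap hJ_meas.aemeasurable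
    _ = _ := by
      refine setLIntegral_congr_fun measurableSet_upper_halfPlane fun x hx ↦ ?_
      have hFx : Measurable (F x) := hF.comp measurable_prodMk_left
      rw [← setLIntegral_halfPlane_add_horizontal x.1,
        setLIntegral_halfPlane_eq_anchoredCirclePoint hx
          (g := fun p ↦ F x (p + (x.1, 0))) (hFx.comp (by fun_prop)),
        ← lintegral_add_right_eq_self _ x.1]
      refine lintegral_congr fun w ↦ lintegral_congr fun υ ↦ ?_
      simp only [hK, anchoredCirclePoint, Prod.mk_add_mk, add_zero, zero_add, add_sub_cancel_right,
        add_right_comm]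
end

section
/- For every integer n ≥ 2, ∫_{ξ=0}^{π/2} ∫_{υ=0}^{π/2} (sin ξ · sin υ)^{n-2} · |cos υ − cos ξ| dξ dυ = (√π/(n−1)) · ( 2·Γ(n−1)/Γ(n−1/2) − Γ((n−1)/2)/Γ(n/2) ), where Γ denotes the Gamma function. -/
open Real MeasureTheory

/-- Wallis' integral on a quarter period, in terms of the Gamma function. -/
theorem integral_sin_pow_zero_pi_div_two (m : ℕ) :
    (∫ x in (0:ℝ)..(π / 2), sin x ^ m) =
      √π / 2 * Gamma (((m : ℝ) + 1) / 2) / Gamma ((m : ℝ) / 2 + 1) := by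
  induction m using Nat.twoStepInduction with
  | zero =>
    have h : √π * √π = π := Real.mul_self_sqrt pi_pos.le
    simp only [pow_zero, intervalIntegral.integral_const, Nat.cast_zero, zero_add, zero_div,
      Gamma_one, Gamma_one_half_eq, smul_eq_mul]
    linear_combination -h / 2
  | one =>
    have h : Gamma ((1 : ℝ) / 2 + 1) = 1 / 2 * √π := by
      rw [Gamma_add_one (by norm_num), Gamma_one_half_eq]
    have hπ : √π ≠ 0 := (Real.sqrt_pos.2 pi_pos).ne'
    simp only [pow_one, integral_sin, cos_zero, cos_pi_div_two, Nat.cast_one, h]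
    norm_num
    field_simp
  | more k ih _ =>
    have hA : Gamma ((((k + 2 : ℕ) : ℝ) + 1) / 2) = ((k : ℝ) + 1) / 2 * Gamma (((k : ℝ) + 1) / 2) := by
      rw [← Gamma_add_one (by positivity)]
      push_cast
      ring_nf
    have hB : Gamma (((k + 2 : ℕ) : ℝ) / 2 + 1) = ((k : ℝ) / 2 + 1) * Gamma ((k : ℝ) / 2 + 1) := by
      rw [← Gamma_add_one (by positivity)]
      push_cast
      ring_nf
    have hpos : Gamma ((k : ℝ) / 2 + 1) ≠ 0 := (Gamma_pos_of_pos (by positivity)).ne'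
    have hk : (k : ℝ) + 2 ≠ 0 := by positivity
    rw [integral_sin_pow, ih, hA, hB]
    simp only [sin_zero, cos_pi_div_two, mul_zero, ne_eq, Nat.add_eq_zero_iff, one_ne_zero,
      and_false, not_false_eq_true, zero_pow, zero_mul, sub_zero, zero_div, zero_add]
    field_simp

theorem hasDerivAt_integral_sin_pow (m : ℕ) (x : ℝ) :
    HasDerivAt (fun x => ∫ t in (0:ℝ)..x, sin t ^ m) (sin x ^ m) x :=
  (continuous_sin.pow m).integral_hasStrictDerivAt 0 x |>.hasDerivAt

theorem hasDerivAt_sin_pow_succ_div (m : ℕ) (x : ℝ) :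
    HasDerivAt (fun x => sin x ^ (m + 1) / ((m : ℝ) + 1)) (sin x ^ m * cos x) x := by
  have hm : (m : ℝ) + 1 ≠ 0 := by positivity
  refine (((hasDerivAt_sin x).pow (m + 1)).div_const ((m : ℝ) + 1)).congr_deriv ?_
  rw [Nat.add_sub_cancel]
  push_cast
  field_simp

theorem integral_sin_pow_mul_cos_sub (m : ℕ) (a b c : ℝ) :
    (∫ υ in a..b, sin υ ^ m * (cos υ - c)) =
      (sin b ^ (m + 1) - sin a ^ (m + 1)) / ((m : ℝ) + 1) -
        c * ((∫ t in (0:ℝ)..b, sin t ^ m) - ∫ t in (0:ℝ)..a, sin t ^ m) := by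
  rw [intervalIntegral.integral_eq_sub_of_hasDerivAt
    (f := fun x => sin x ^ (m + 1) / ((m : ℝ) + 1) - c * ∫ t in (0:ℝ)..x, sin t ^ m)]
  · ring
  · intro x _
    refine ((hasDerivAt_sin_pow_succ_div m x).sub
      ((hasDerivAt_integral_sin_pow m x).const_mul c)).congr_deriv ?_
    ring
  · exact (by fun_prop : Continuous fun υ => sin υ ^ m * (cos υ - c)).intervalIntegrable _ _

theorem integral_sin_pow_mul_abs_cos_sub_const (m : ℕ) {ξ : ℝ} (h0 : 0 ≤ ξ) (h1 : ξ ≤ π / 2) :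
    (∫ υ in (0:ℝ)..(π / 2), sin υ ^ m * |cos υ - cos ξ|) =
      (2 * sin ξ ^ (m + 1) - 1) / ((m : ℝ) + 1) +
        cos ξ * ((∫ t in (0:ℝ)..(π / 2), sin t ^ m) - 2 * ∫ t in (0:ℝ)..ξ, sin t ^ m) := by
  have hc : Continuous fun υ => sin υ ^ m * |cos υ - cos ξ| := by fun_prop
  have hleft : (∫ υ in (0:ℝ)..ξ, sin υ ^ m * |cos υ - cos ξ|) =
      ∫ υ in (0:ℝ)..ξ, sin υ ^ m * (cos υ - cos ξ) := by
    refine intervalIntegral.integral_congr fun υ hυ => ?_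
    rw [Set.uIcc_of_le h0] at hυ
    have := cos_le_cos_of_nonneg_of_le_pi hυ.1 (by linarith [pi_pos]) hυ.2
    simp only [abs_of_nonneg (sub_nonneg.2 this)]
  have hright : (∫ υ in ξ..(π / 2), sin υ ^ m * |cos υ - cos ξ|) =
      -∫ υ in ξ..(π / 2), sin υ ^ m * (cos υ - cos ξ) := by
    rw [← intervalIntegral.integral_neg]
    refine intervalIntegral.integral_congr fun υ hυ => ?_
    rw [Set.uIcc_of_le h1] at hυ
    have := cos_le_cos_of_nonneg_of_le_pi h0 (by linarith [pi_pos, hυ.2]) hυ.1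
    simp only [abs_of_nonpos (sub_nonpos.2 this), mul_neg]
  rw [← intervalIntegral.integral_add_adjacent_intervals (hc.intervalIntegrable 0 ξ)
    (hc.intervalIntegrable ξ (π / 2)), hleft, hright, integral_sin_pow_mul_cos_sub,
    integral_sin_pow_mul_cos_sub]
  simp only [sin_zero, sin_pi_div_two, one_pow, intervalIntegral.integral_same, ne_eq,
    Nat.add_eq_zero_iff, one_ne_zero, and_false, not_false_eq_true, zero_pow]
  ring

theorem integral_integral_sin_pow_mul_abs_cos_sub (m : ℕ) :
    (∫ ξ in (0:ℝ)..(π / 2), ∫ υ in (0:ℝ)..(π / 2), (sin ξ * sin υ) ^ m * |cos υ - cos ξ|) =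
      2 / ((m : ℝ) + 1) * (2 * (∫ t in (0:ℝ)..(π / 2), sin t ^ (2 * m + 1)) -
        ∫ t in (0:ℝ)..(π / 2), sin t ^ m) := by
  have hm : (m : ℝ) + 1 ≠ 0 := by positivity
  set S : ℝ → ℝ := fun x => ∫ t in (0:ℝ)..x, sin t ^ m with hS
  have hSd : ∀ x, HasDerivAt S (sin x ^ m) x := hasDerivAt_integral_sin_pow m
  have hSc : Continuous S := continuous_iff_continuousAt.2 fun x => (hSd x).continuousAt
  have hinner : Set.EqOn
      (fun ξ => ∫ υ in (0:ℝ)..(π / 2), (sin ξ * sin υ) ^ m * |cos υ - cos ξ|)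
      (fun ξ => sin ξ ^ m * ((2 * sin ξ ^ (m + 1) - 1) / ((m : ℝ) + 1) +
        cos ξ * (S (π / 2) - 2 * S ξ))) (Set.uIcc 0 (π / 2)) := by
    intro ξ hξ
    rw [Set.uIcc_of_le (by positivity)] at hξ
    simp only [mul_pow, mul_assoc, intervalIntegral.integral_const_mul]
    rw [integral_sin_pow_mul_abs_cos_sub_const m hξ.1 hξ.2]
  rw [intervalIntegral.integral_congr hinner, intervalIntegral.integral_eq_sub_of_hasDerivAt
    (f := fun x => 4 / ((m : ℝ) + 1) * (∫ t in (0:ℝ)..x, sin t ^ (2 * m + 1)) +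
      sin x ^ (m + 1) / ((m : ℝ) + 1) * (S (π / 2) - 2 * S x) - S x / ((m : ℝ) + 1))]
  · simp only [hS, sin_zero, sin_pi_div_two, one_pow, intervalIntegral.integral_same, ne_eq,
      Nat.add_eq_zero_iff, one_ne_zero, and_false, not_false_eq_true, zero_pow]
    ring
  · intro x _
    refine ((((hasDerivAt_integral_sin_pow (2 * m + 1) x).const_mul (4 / ((m : ℝ) + 1))).add
      ((hasDerivAt_sin_pow_succ_div m x).mul
        (((hSd x).const_mul 2).const_sub (S (π / 2))))).sub
      ((hSd x).div_const ((m : ℝ) + 1))).congr_deriv ?_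
    ring
  · exact (by fun_prop : Continuous fun ξ => sin ξ ^ m *
      ((2 * sin ξ ^ (m + 1) - 1) / ((m : ℝ) + 1) +
        cos ξ * (S (π / 2) - 2 * S ξ))).intervalIntegrable _ _

/-- For every integer `n ≥ 2`,
`∫_{0}^{π/2} ∫_{0}^{π/2} (sin ξ sin υ)^{n-2} |cos υ - cos ξ| dξ dυ
  = (√π/(n-1)) (2Γ(n-1)/Γ(n-1/2) - Γ((n-1)/2)/Γ(n/2))`. -/
theorem integral_sin_pow_mul_abs_cos_sub (n : ℕ) (hn : 2 ≤ n) :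
    (∫ ξ in (0:ℝ)..(Real.pi / 2), ∫ υ in (0:ℝ)..(Real.pi / 2),
        (Real.sin ξ * Real.sin υ) ^ (n - 2) * |Real.cos υ - Real.cos ξ|) =
      Real.sqrt Real.pi / ((n : ℝ) - 1) *
        (2 * Real.Gamma ((n : ℝ) - 1) / Real.Gamma ((n : ℝ) - 1 / 2) -
          Real.Gamma (((n : ℝ) - 1) / 2) / Real.Gamma ((n : ℝ) / 2)) := by
  obtain ⟨m, rfl⟩ := Nat.exists_eq_add_of_le' hn
  rw [Nat.add_sub_cancel, integral_integral_sin_pow_mul_abs_cos_sub,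
    integral_sin_pow_zero_pi_div_two, integral_sin_pow_zero_pi_div_two]
  push_cast
  rw [show (2 * (m : ℝ) + 1 + 1) / 2 = m + 1 by ring,
    show (2 * (m : ℝ) + 1) / 2 + 1 = m + 3 / 2 by ring,
    show (m : ℝ) + 2 - 1 = m + 1 by ring, show (m : ℝ) + 2 - 1 / 2 = m + 3 / 2 by ring,
    show ((m : ℝ) + 2) / 2 = m / 2 + 1 by ring]
  ring
end

section
/- Let σ_m = 2π^{m/2}/Γ(m/2) denote the surface area of the unit sphere in ℝ^m and ν_m = π^{m/2}/Γ(m/2 + 1) the volume of the unit ball in ℝ^m, and for an integer n ≥ 2 set C_n = σ_{n-1} · Γ(1 − 1/n) / ( n · ν_n^{1 − 1/n} ). Then C_n → √e as n → ∞. -/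
open Real Filter

/-- Surface area of the unit sphere in `ℝ^m`. -/
noncomputable def sphereArea (m : ℕ) : ℝ := 2 * Real.pi ^ ((m : ℝ) / 2) / Real.Gamma ((m : ℝ) / 2)

/-- Volume of the unit ball in `ℝ^m`. -/
noncomputable def ballVolume (m : ℕ) : ℝ := Real.pi ^ ((m : ℝ) / 2) / Real.Gamma ((m : ℝ) / 2 + 1)

lemma log_Gamma_add_one {x : ℝ} (hx : 0 < x) :
    log (Gamma (x + 1)) = log (Gamma x) + log x := by
  rw [Gamma_add_one hx.ne', log_mul hx.ne' (Gamma_pos_of_pos hx).ne', add_comm]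

lemma log_Gamma_add_half_le {x : ℝ} (hx : 0 < x) :
    log (Gamma (x + 1 / 2)) ≤ log (Gamma x) + 1 / 2 * log x := by
  have h := convexOn_log_Gamma.2 hx
    (Set.mem_Ioi.2 (by linarith : (0 : ℝ) < x + 1))
    (by norm_num : (0 : ℝ) ≤ 1 / 2) (by norm_num : (0 : ℝ) ≤ 1 / 2) (by norm_num)
  simp only [smul_eq_mul, Function.comp_apply, log_Gamma_add_one hx] at h
  rw [show 1 / 2 * x + 1 / 2 * (x + 1) = x + 1 / 2 by ring] at h
  linarith

lemma tendsto_log_Gamma_add_half_sub :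
    Tendsto (fun x : ℝ => log (Gamma (x + 1 / 2)) - log (Gamma x) - 1 / 2 * log x)
      atTop (nhds 0) := by
  have hlow : Tendsto (fun x : ℝ => 1 / 2 * (log (x + -(1 / 2)) - log x)) atTop (nhds 0) := by
    simpa using (tendsto_log_comp_add_sub_log (-(1 / 2))).const_mul (1 / 2 : ℝ)
  refine tendsto_of_tendsto_of_tendsto_of_le_of_le' hlow tendsto_const_nhds ?_ ?_
  · filter_upwards [eventually_gt_atTop 1] with x hx
    have hx' : 0 < x + -(1 / 2) := by linarith
    have h := log_Gamma_add_half_le hx'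
    have h' := log_Gamma_add_one hx'
    rw [show x + -(1 / 2) + 1 / 2 = x by ring] at h
    rw [show x + -(1 / 2) + 1 = x + 1 / 2 by ring] at h'
    linarith
  · filter_upwards [eventually_gt_atTop 0] with x hx
    linarith [log_Gamma_add_half_le hx]

/-- Stirling's formula at half-integers, to leading order, from the duplication formula. -/
lemma tendsto_log_Gamma_half_div :
    Tendsto (fun n : ℕ => log (Gamma ((n : ℝ) / 2 + 1)) / n - 1 / 2 * log ((n : ℝ) / 2))
      atTop (nhds (-(1 / 2))) := by
  have hinv : Tendsto (fun n : ℕ => (n : ℝ)⁻¹) atTop (nhds 0) :=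
    tendsto_inv_atTop_nhds_zero_nat
  have hlog : Tendsto (fun n : ℕ => log n * (n : ℝ)⁻¹) atTop (nhds 0) := by
    simpa [div_eq_mul_inv, Function.comp_def] using
      (isLittleO_log_id_atTop.tendsto_div_nhds_zero).comp tendsto_natCast_atTop_atTop
  have hstir : Tendsto (fun n : ℕ => log (Stirling.stirlingSeq n)) atTop (nhds (log √π)) :=
    Stirling.tendsto_stirlingSeq_sqrt_pi.log (by positivity)
  have hshift : Tendsto (fun n : ℕ => log ((n : ℝ) + 1) - log n) atTop (nhds 0) :=
    (tendsto_log_comp_add_sub_log 1).comp tendsto_natCast_atTop_atTop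
  have hy : Tendsto (fun n : ℕ => ((n : ℝ) + 1) / 2) atTop atTop :=
    (tendsto_atTop_add_const_right _ _ tendsto_natCast_atTop_atTop).atTop_div_const two_pos
  have hratio := tendsto_log_Gamma_add_half_sub.comp hy
  have hmain := (((hstir.add (hratio.add (hshift.const_mul (1 / 2)))).add_const
    (log √π)).mul hinv |>.add hlog).const_mul (1 / 2) |>.add_const (-(1 / 2))
  simp only [mul_zero, add_zero, zero_add] at hmain
  refine hmain.congr' ?_
  filter_upwards [eventually_gt_atTop 0] with n hn
  have hn' : (0 : ℝ) < n := by exact_mod_cast hn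
  have hy0 : (0 : ℝ) < ((n : ℝ) + 1) / 2 := by positivity
  have hdup := congrArg log (Gamma_mul_Gamma_add_half (((n : ℝ) + 1) / 2))
  rw [show 2 * (((n : ℝ) + 1) / 2) = n + 1 by ring, Gamma_nat_eq_factorial,
    log_mul (Gamma_pos_of_pos hy0).ne' (Gamma_pos_of_pos (by positivity)).ne',
    log_mul (by positivity) (by positivity), log_mul (by positivity) (by positivity),
    log_rpow two_pos] at hdup
  have hS := Stirling.log_stirlingSeq_formula n
  rw [log_div hn'.ne' (exp_pos 1).ne', log_exp, log_mul two_ne_zero hn'.ne'] at hS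
  simp only [Function.comp_apply]
  rw [log_div (by positivity) two_ne_zero, log_div hn'.ne' two_ne_zero, hS]
  rw [show ((n : ℝ) + 1) / 2 + 1 / 2 = n / 2 + 1 by ring] at hdup ⊢
  have hdiv : ((n : ℝ) + 2) / 2 = n / 2 + 1 := by ring
  field_simp
  rw [hdiv]
  linarith

lemma log_criticalVertexConstant {n : ℕ} (hn : 2 ≤ n) :
    log (sphereArea (n - 1) * Gamma (1 - 1 / n) / (n * ballVolume n ^ (1 - 1 / (n : ℝ)))) =
      log (Gamma ((n : ℝ) / 2)) - log (Gamma (((n : ℝ) - 1) / 2))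
        - log (Gamma ((n : ℝ) / 2 + 1)) / n + log (Gamma (1 - 1 / n)) := by
  have hn' : (2 : ℝ) ≤ n := by exact_mod_cast hn
  have h0 : (0 : ℝ) < n := by linarith
  have h1 : (0 : ℝ) < 1 - 1 / n := by
    rw [sub_pos, div_lt_one h0]; linarith
  have g1 : 0 < Gamma (((n : ℝ) - 1) / 2) := Gamma_pos_of_pos (by linarith)
  have g2 : 0 < Gamma ((n : ℝ) / 2 + 1) := Gamma_pos_of_pos (by linarith)
  have g3 := Gamma_pos_of_pos h1
  have hp := pi_pos
  unfold sphereArea ballVolume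
  rw [Nat.cast_sub (by omega), Nat.cast_one, log_div (by positivity) (by positivity),
    log_mul (by positivity) g3.ne', log_mul h0.ne' (by positivity),
    log_div (by positivity) g1.ne', log_mul two_ne_zero (by positivity),
    log_rpow (by positivity), log_rpow (by positivity), log_div (by positivity) g2.ne',
    log_rpow (by positivity), log_Gamma_add_one (by positivity : (0 : ℝ) < n / 2),
    log_div h0.ne' two_ne_zero]
  field_simp
  ring

lemma criticalVertexConstant_pos {n : ℕ} (hn : 2 ≤ n) :
    0 < sphereArea (n - 1) * Gamma (1 - 1 / n) / (n * ballVolume n ^ (1 - 1 / (n : ℝ))) := by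
  have hn' : (2 : ℝ) ≤ n := by exact_mod_cast hn
  have h0 : (0 : ℝ) < n := by linarith
  have h1 : (0 : ℝ) < 1 - 1 / n := by
    rw [sub_pos, div_lt_one h0]; linarith
  have g1 : 0 < Gamma (((n : ℝ) - 1) / 2) := Gamma_pos_of_pos (by linarith)
  have g2 : 0 < Gamma ((n : ℝ) / 2 + 1) := Gamma_pos_of_pos (by linarith)
  have g3 := Gamma_pos_of_pos h1
  have hp := pi_pos
  unfold sphereArea ballVolume
  rw [Nat.cast_sub (by omega), Nat.cast_one]
  positivity

/-- The constant `C_n = σ_{n-1} Γ(1 - 1/n) / (n ν_n^{1-1/n})` tends to `√e` as `n → ∞`. -/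
theorem tendsto_criticalVertexConstant_sqrt_exp_one :
    Tendsto (fun n : ℕ =>
        sphereArea (n - 1) * Real.Gamma (1 - 1 / n) /
          (n * ballVolume n ^ (1 - 1 / (n : ℝ))))
      atTop (nhds (Real.sqrt (Real.exp 1))) := by
  have hy : Tendsto (fun n : ℕ => ((n : ℝ) - 1) / 2) atTop atTop :=
    (tendsto_atTop_add_const_right _ _ tendsto_natCast_atTop_atTop).atTop_div_const two_pos
  have hratio := tendsto_log_Gamma_add_half_sub.comp hy
  have hshift : Tendsto (fun n : ℕ => log ((n : ℝ) + -1) - log n) atTop (nhds 0) :=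
    (tendsto_log_comp_add_sub_log (-1)).comp tendsto_natCast_atTop_atTop
  have hGamma : Tendsto (fun n : ℕ => log (Gamma (1 - 1 / n))) atTop (nhds 0) := by
    have hone : Tendsto (fun n : ℕ => 1 - 1 / (n : ℝ)) atTop (nhds 1) := by
      simpa using tendsto_one_div_atTop_nhds_zero_nat (𝕜 := ℝ) |>.const_sub 1
    have hc : ContinuousAt Gamma 1 :=
      (differentiableAt_Gamma fun m => by
        have : (0 : ℝ) ≤ m := m.cast_nonneg
        linarith).continuousAt
    simpa using (hc.tendsto.comp hone).log (by simp)
  have hmain := ((hratio.add (hshift.const_mul (1 / 2))).sub tendsto_log_Gamma_half_div).add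
    hGamma
  rw [← exp_half]
  simp only [mul_zero, add_zero, zero_sub, neg_neg] at hmain
  refine (continuous_exp.tendsto _ |>.comp hmain).congr' ?_
  filter_upwards [eventually_ge_atTop 2] with n hn
  have hn' : (2 : ℝ) ≤ n := by exact_mod_cast hn
  rw [← exp_log (criticalVertexConstant_pos hn), log_criticalVertexConstant hn]
  simp only [Function.comp_apply]
  rw [show ((n : ℝ) - 1) / 2 + 1 / 2 = n / 2 by ring, ← sub_eq_add_neg,
    log_div (x := (n : ℝ) - 1) (by linarith) two_ne_zero,
    log_div (x := (n : ℝ)) (by linarith) two_ne_zero]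
  congr 1
  ring
end

section
/- Let σ_m = 2π^{m/2}/Γ(m/2) denote the surface area of the unit sphere in ℝ^m and ν_m = π^{m/2}/Γ(m/2 + 1) the volume of the unit ball in ℝ^m, and for an integer n ≥ 2 set C_n' = ( σ_{n-1}² · √π · Γ(2 − 1/n) / ( n(n−1) · ν_n^{2 − 1/n} ) ) · ( 2·Γ(n−1)/Γ(n−1/2) − Γ((n−1)/2)/Γ(n/2) ). Then C_n' → √e · (√2 − 1) as n → ∞. -/
open Real Filter

/-- The ratio `Γ(x + 1/2) / (Γ(x) √x)`, which tends to `1` at infinity. -/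
noncomputable def gammaHalfRatio (x : ℝ) : ℝ := Gamma (x + 1 / 2) / (Gamma x * √x)

lemma gammaHalfRatio_pos {x : ℝ} (hx : 0 < x) : 0 < gammaHalfRatio x := by
  have := Gamma_pos_of_pos hx
  have := Gamma_pos_of_pos (show 0 < x + 1 / 2 by linarith)
  unfold gammaHalfRatio
  positivity

lemma Gamma_add_half_eq {x : ℝ} (hx : 0 < x) :
    Gamma (x + 1 / 2) = gammaHalfRatio x * (Gamma x * √x) := by
  have := Gamma_pos_of_pos hx
  unfold gammaHalfRatio
  field_simp

/-- Midpoint log-convexity of the Gamma function. -/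
lemma Gamma_add_half_sq_le {x : ℝ} (hx : 0 < x) :
    Gamma (x + 1 / 2) ^ 2 ≤ Gamma x * Gamma (x + 1) := by
  have h := Gamma_mul_add_mul_le_rpow_Gamma_mul_rpow_Gamma (s := x) (t := x + 1)
    (a := 1 / 2) (b := 1 / 2) hx (by linarith) (by norm_num) (by norm_num) (by norm_num)
  have h1 := Gamma_pos_of_pos hx
  have h2 := Gamma_pos_of_pos (show 0 < x + 1 by linarith)
  rw [show 1 / 2 * x + 1 / 2 * (x + 1) = x + 1 / 2 by ring, ← sqrt_eq_rpow, ← sqrt_eq_rpow,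
    ← sqrt_mul h1.le] at h
  exact (le_sqrt (Gamma_pos_of_pos (by linarith)).le (by positivity)).1 h

lemma gammaHalfRatio_le_one {x : ℝ} (hx : 0 < x) : gammaHalfRatio x ≤ 1 := by
  have h1 := Gamma_pos_of_pos hx
  have h := Gamma_add_half_sq_le hx
  rw [Gamma_add_one hx.ne'] at h
  unfold gammaHalfRatio
  rw [div_le_one (by positivity)]
  refine le_of_sq_le_sq ?_ (by positivity)
  rw [mul_pow, sq_sqrt hx.le]
  linarith

lemma sqrt_one_sub_le_gammaHalfRatio {x : ℝ} (hx : 1 / 2 < x) :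
    √(1 - 1 / 2 / x) ≤ gammaHalfRatio x := by
  have hx0 : 0 < x := by linarith
  have h1 := Gamma_pos_of_pos hx0
  have h2 : 0 < x - 1 / 2 := by linarith
  have h := Gamma_add_half_sq_le h2
  have h3 := Gamma_add_one h2.ne'
  rw [show x - 1 / 2 + 1 / 2 = x by ring] at h
  rw [show x - 1 / 2 + 1 = x + 1 / 2 by ring] at h h3
  refine sqrt_le_iff.2 ⟨(gammaHalfRatio_pos hx0).le, ?_⟩
  unfold gammaHalfRatio
  rw [div_pow, mul_pow, sq_sqrt hx0.le, le_div_iff₀ (by positivity)]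
  calc (1 - 1 / 2 / x) * (Gamma x ^ 2 * x) = (x - 1 / 2) * Gamma x ^ 2 := by field_simp
    _ ≤ (x - 1 / 2) * (Gamma (x - 1 / 2) * Gamma (x + 1 / 2)) := by gcongr
    _ = Gamma (x + 1 / 2) ^ 2 := by linear_combination (-Gamma (x + 1 / 2)) * h3

lemma tendsto_gammaHalfRatio : Tendsto gammaHalfRatio atTop (nhds 1) := by
  refine tendsto_of_tendsto_of_tendsto_of_le_of_le' (g := fun x : ℝ => √(1 - 1 / 2 / x)) ?_
    tendsto_const_nhds ?_ ?_
  · have h : Tendsto (fun x : ℝ => 1 - 1 / 2 / x) atTop (nhds (1 - 0)) :=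
      tendsto_const_nhds.sub (tendsto_const_nhds.div_atTop tendsto_id)
    simpa using h.sqrt
  · filter_upwards [eventually_gt_atTop (1 / 2)] with x hx
    exact sqrt_one_sub_le_gammaHalfRatio hx
  · filter_upwards [eventually_gt_atTop 0] with x hx
    exact gammaHalfRatio_le_one hx

/-- The subexponential correction in `Γ(n/2 + 1)² = (n / (2e))^n n U_n`. -/
noncomputable def halfStirlingFactor (n : ℕ) : ℝ :=
  √π * Stirling.stirlingSeq n * gammaHalfRatio (((n : ℝ) + 1) / 2) * √(1 + 1 / n)

lemma Gamma_half_add_one_sq {n : ℕ} (hn : 0 < n) :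
    Gamma ((n : ℝ) / 2 + 1) ^ 2 =
      ((n : ℝ) / (2 * exp 1)) ^ n * n * halfStirlingFactor n := by
  have hn0 : (0 : ℝ) < n := by exact_mod_cast hn
  have hd := Gamma_mul_Gamma_add_half (((n : ℝ) + 1) / 2)
  have hg := Gamma_add_half_eq (show 0 < ((n : ℝ) + 1) / 2 by positivity)
  rw [show 2 * (((n : ℝ) + 1) / 2) = n + 1 by ring, Gamma_nat_eq_factorial,
    show 1 - ((n : ℝ) + 1) = -n by ring, rpow_neg (by norm_num), rpow_natCast] at hd
  rw [show ((n : ℝ) + 1) / 2 + 1 / 2 = n / 2 + 1 by ring] at hd hg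
  have hs : √(2 * (n : ℝ)) * √(((n : ℝ) + 1) / 2) = n * √(1 + 1 / n) := by
    rw [← sqrt_mul (by positivity)]
    nth_rewrite 3 [← sqrt_sq hn0.le]
    rw [← sqrt_mul (by positivity)]
    congr 1
    field_simp
  have hf : (n.factorial : ℝ) = √(2 * (n : ℝ)) * (n / exp 1) ^ n * Stirling.stirlingSeq n := by
    unfold Stirling.stirlingSeq
    field_simp
  calc Gamma ((n : ℝ) / 2 + 1) ^ 2
      = (Gamma (((n : ℝ) + 1) / 2) * Gamma ((n : ℝ) / 2 + 1)) *
          (gammaHalfRatio (((n : ℝ) + 1) / 2) * √(((n : ℝ) + 1) / 2)) := by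
        rw [hg]; ring
    _ = (√(2 * (n : ℝ)) * √(((n : ℝ) + 1) / 2)) * ((n / exp 1) ^ n * (2 ^ n)⁻¹) *
          (√π * Stirling.stirlingSeq n * gammaHalfRatio (((n : ℝ) + 1) / 2)) := by
        rw [hd, hf]; ring
    _ = _ := by
        rw [hs, halfStirlingFactor, ← inv_pow, ← mul_pow,
          show (n : ℝ) / exp 1 * 2⁻¹ = n / (2 * exp 1) by field_simp]
        ring

lemma tendsto_halfStirlingFactor : Tendsto halfStirlingFactor atTop (nhds π) := by
  have h1 : Tendsto (fun n : ℕ => ((n : ℝ) + 1) / 2) atTop atTop :=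
    (tendsto_atTop_add_const_right _ _ tendsto_natCast_atTop_atTop).atTop_div_const (by norm_num)
  have h2 : Tendsto (fun n : ℕ => √(1 + 1 / (n : ℝ))) atTop (nhds √(1 + 0)) :=
    (tendsto_const_nhds.add tendsto_one_div_atTop_nhds_zero_nat).sqrt
  have h := ((Stirling.tendsto_stirlingSeq_sqrt_pi.const_mul √π).mul
    (tendsto_gammaHalfRatio.comp h1)).mul h2
  rw [mul_self_sqrt pi_pos.le, add_zero, sqrt_one, mul_one, mul_one] at h
  exact h

lemma tendsto_Gamma_half_add_one_rpow :
    Tendsto (fun n : ℕ => Gamma ((n : ℝ) / 2 + 1) ^ (1 / (n : ℝ)) / √n) atTop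
      (nhds √(1 / (2 * exp 1))) := by
  have h1 : Tendsto (fun n : ℕ => halfStirlingFactor n ^ (1 / (n : ℝ))) atTop
      (nhds (π ^ (0 : ℝ))) :=
    tendsto_halfStirlingFactor.rpow tendsto_one_div_atTop_nhds_zero_nat (Or.inl pi_ne_zero)
  have h2 : Tendsto (fun n : ℕ => (n : ℝ) ^ (1 / (n : ℝ))) atTop (nhds 1) :=
    tendsto_rpow_div.comp tendsto_natCast_atTop_atTop
  have h := ((h2.mul h1).const_mul (1 / (2 * exp 1))).sqrt
  rw [rpow_zero, mul_one, mul_one] at h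
  refine h.congr' ?_
  filter_upwards [eventually_gt_atTop 0,
    tendsto_halfStirlingFactor.eventually (lt_mem_nhds pi_pos)] with n hn hU
  have hn0 : (0 : ℝ) < n := by exact_mod_cast hn
  have hG := Gamma_pos_of_pos (show 0 < (n : ℝ) / 2 + 1 by positivity)
  rw [sqrt_eq_iff_mul_self_eq (by positivity) (by positivity),
    div_mul_div_comm, mul_self_sqrt hn0.le, ← mul_rpow hG.le hG.le, ← sq,
    Gamma_half_add_one_sq hn, mul_rpow (by positivity) hU.le,
    mul_rpow (by positivity) hn0.le, one_div (n : ℝ), pow_rpow_inv_natCast (by positivity) hn.ne']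
  field_simp

lemma ballVolume_pos (n : ℕ) : 0 < ballVolume n := by
  have := Gamma_pos_of_pos (show 0 < (n : ℝ) / 2 + 1 by positivity)
  unfold ballVolume
  positivity

lemma ballVolume_rpow_one_div {n : ℕ} (hn : 0 < n) :
    ballVolume n ^ (1 / (n : ℝ)) = √π / Gamma ((n : ℝ) / 2 + 1) ^ (1 / (n : ℝ)) := by
  have hn0 : (n : ℝ) ≠ 0 := by exact_mod_cast hn.ne'
  have := Gamma_pos_of_pos (show 0 < (n : ℝ) / 2 + 1 by positivity)
  rw [ballVolume, div_rpow (by positivity) this.le, ← rpow_mul pi_pos.le, sqrt_eq_rpow]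
  congr 2
  field_simp

lemma sphereArea_sq_div_ballVolume_sq {n : ℕ} (hn : 2 ≤ n) :
    sphereArea (n - 1) ^ 2 / ballVolume n ^ 2 =
      (n : ℝ) ^ 2 * ((n : ℝ) - 1) / (2 * π) * gammaHalfRatio (((n : ℝ) - 1) / 2) ^ 2 := by
  have hn2 : (2 : ℝ) ≤ n := by exact_mod_cast hn
  have hx : 0 < ((n : ℝ) - 1) / 2 := by linarith
  have h1 := Gamma_pos_of_pos hx
  have hg := Gamma_add_half_eq hx
  have h2 := gammaHalfRatio_pos hx
  have h3 : √(((n : ℝ) - 1) / 2) ^ 2 = ((n : ℝ) - 1) / 2 := sq_sqrt hx.le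
  have h4 : 0 < √(((n : ℝ) - 1) / 2) := sqrt_pos.2 hx
  rw [show ((n : ℝ) - 1) / 2 + 1 / 2 = n / 2 by ring] at hg
  rw [sphereArea, ballVolume, Nat.cast_sub (by omega), Nat.cast_one,
    Gamma_add_one (by linarith), hg]
  have h5 : π ^ ((n : ℝ) / 2) = π ^ (((n : ℝ) - 1) / 2) * √π := by
    rw [sqrt_eq_rpow, ← rpow_add pi_pos]; congr 1; ring
  have h6 : √π ^ 2 = π := sq_sqrt pi_pos.le
  rw [h5]
  simp only [div_pow, mul_pow, h6, h3]
  field_simp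

/-- The constant
`C_n' = (σ_{n-1}² √π Γ(2 - 1/n) / (n(n-1) ν_n^{2-1/n})) (2Γ(n-1)/Γ(n-1/2) - Γ((n-1)/2)/Γ(n/2))`
tends to `√e (√2 - 1)` as `n → ∞`. -/
theorem tendsto_vertexEdgeConstant_sqrt_exp_one_mul :
    Tendsto (fun n : ℕ =>
        sphereArea (n - 1) ^ 2 * Real.sqrt Real.pi * Real.Gamma (2 - 1 / n) /
            ((n : ℝ) * ((n : ℝ) - 1) * ballVolume n ^ (2 - 1 / (n : ℝ))) *
          (2 * Real.Gamma ((n : ℝ) - 1) / Real.Gamma ((n : ℝ) - 1 / 2) -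
            Real.Gamma (((n : ℝ) - 1) / 2) / Real.Gamma ((n : ℝ) / 2)))
      atTop (nhds (Real.sqrt (Real.exp 1) * (Real.sqrt 2 - 1))) := by
  have hhalf : Tendsto (fun n : ℕ => ((n : ℝ) - 1) / 2) atTop atTop :=
    (tendsto_atTop_add_const_right _ (-1) tendsto_natCast_atTop_atTop).atTop_div_const (by norm_num)
  have hone : Tendsto (fun n : ℕ => (n : ℝ) - 1) atTop atTop :=
    tendsto_atTop_add_const_right _ (-1) tendsto_natCast_atTop_atTop
  have ha := tendsto_gammaHalfRatio.comp hhalf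
  have hb := tendsto_gammaHalfRatio.comp hone
  have hΓ : Tendsto (fun n : ℕ => Gamma (2 - 1 / (n : ℝ))) atTop (nhds 1) := by
    have h : Tendsto (fun n : ℕ => 2 - 1 / (n : ℝ)) atTop (nhds 2) := by
      simpa using (tendsto_one_div_atTop_nhds_zero_nat (𝕜 := ℝ)).const_sub 2
    have hc : ContinuousAt Gamma 2 :=
      (differentiableOn_Gamma_Ioi.differentiableAt
        (Ioi_mem_nhds two_pos)).continuousAt
    simpa [Function.comp_def] using hc.tendsto.comp h
  have hr : Tendsto (fun n : ℕ => √(1 + 1 / ((n : ℝ) - 1))) atTop (nhds 1) := by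
    simpa using ((tendsto_const_nhds (x := (1 : ℝ))).add
      ((tendsto_const_nhds (x := (1 : ℝ))).div_atTop hone)).sqrt
  have hB := tendsto_Gamma_half_add_one_rpow.inv₀ (by positivity)
  have h := (((((ha.pow 2).div_const 2).mul hΓ).mul hr).mul hB).mul
    (((tendsto_const_nhds (x := (2 : ℝ))).div hb one_ne_zero).sub
      ((tendsto_const_nhds (x := √2)).div ha one_ne_zero))
  have hlim : (1 : ℝ) ^ 2 / 2 * 1 * 1 * (√(1 / (2 * exp 1)))⁻¹ * (2 / 1 - √2 / 1) =
      √(exp 1) * (√2 - 1) := by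
    have h2 : √2 * √2 = (2 : ℝ) := mul_self_sqrt (by norm_num)
    rw [one_div, sqrt_inv, inv_inv, sqrt_mul (by norm_num)]
    linear_combination (-(√(exp 1)) / 2) * h2
  rw [hlim] at h
  refine h.congr' ?_
  filter_upwards [eventually_ge_atTop 2] with n hn
  have hn2 : (2 : ℝ) ≤ n := by exact_mod_cast hn
  have hx : 0 < ((n : ℝ) - 1) / 2 := by linarith
  have hy : 0 < (n : ℝ) - 1 := by linarith
  have hν := ballVolume_pos n
  have hG := Gamma_pos_of_pos (show 0 < (n : ℝ) / 2 + 1 by positivity)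
  have hΓx := Gamma_pos_of_pos hx
  have hΓy := Gamma_pos_of_pos hy
  have hgx := gammaHalfRatio_pos hx
  have hgy := gammaHalfRatio_pos hy
  have hsx := Gamma_add_half_eq hx
  have hsy := Gamma_add_half_eq hy
  rw [show ((n : ℝ) - 1) / 2 + 1 / 2 = n / 2 by ring] at hsx
  rw [show (n : ℝ) - 1 + 1 / 2 = n - 1 / 2 by ring] at hsy
  have hσ := sphereArea_sq_div_ballVolume_sq hn
  have hbr : 2 * Gamma ((n : ℝ) - 1) / Gamma ((n : ℝ) - 1 / 2) -
      Gamma (((n : ℝ) - 1) / 2) / Gamma ((n : ℝ) / 2) =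
      (2 / gammaHalfRatio ((n : ℝ) - 1) - √2 / gammaHalfRatio (((n : ℝ) - 1) / 2)) /
        √((n : ℝ) - 1) := by
    rw [hsx, hsy, sqrt_div hy.le]
    field_simp
  have hq : √(1 + 1 / ((n : ℝ) - 1)) = √n / √((n : ℝ) - 1) := by
    rw [← sqrt_div (by positivity)]; congr 1; field_simp; ring
  have hpow : ballVolume n ^ (2 - 1 / (n : ℝ)) =
      ballVolume n ^ 2 / (√π / Gamma ((n : ℝ) / 2 + 1) ^ (1 / (n : ℝ))) := by
    rw [rpow_sub hν, ballVolume_rpow_one_div (by omega), rpow_two]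
  rw [div_eq_iff (by positivity)] at hσ
  rw [hbr, hpow, hσ]
  simp only [Function.comp_apply, Pi.div_apply]
  rw [hq]
  have hs : √(n : ℝ) ^ 2 = n := sq_sqrt (by positivity)
  have hπ : √π ^ 2 = π := sq_sqrt pi_pos.le
  have hL : 0 < Gamma ((n : ℝ) / 2 + 1) ^ (1 / (n : ℝ)) := by positivity
  generalize Gamma ((n : ℝ) / 2 + 1) ^ (1 / (n : ℝ)) = L at hL ⊢
  generalize 2 / gammaHalfRatio ((n : ℝ) - 1) - √2 / gammaHalfRatio (((n : ℝ) - 1) / 2) = D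
  field_simp
  rw [hs, hπ]
  ring
end
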